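/- (Multiplicative Lidskii inequality with equality case.) Let S be a positive definite d×d complex matrix and let λ ∈ ℝ_{>0}^d be non-increasing. Then for every d×d complex matrix V with λ(V^*V) = λ one has λ(S) ∘ λ↑ ≺_log λ(V S V^*) ≺_log λ(S) ∘ λ. Moreover, if λ(V S V^*) = (λ(S) ∘ λ↑)↓ (respectively λ(V S V^*) = λ(S) ∘ λ), then there exists an orthonormal basis (v_1, …, v_d) of ℂ^d such that S = Σ_{i=1}^d λ_i(S) v_i⊗v_i and |V| = Σ_{i=1}^d λ_{d+1−i}^{1/2} v_i⊗v_i (respectively |V| = Σ_{i=1}^d λ_i^{1/2} v_i⊗v_i). -/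

import Mathlib

open Matrix
open scoped ComplexOrder

noncomputable section

/-- Partial products of the first `k` entries of a `d`-tuple. -/
def pprodd {d : ℕ} (x : Fin d → ℝ) (k : ℕ) : ℝ :=
  ∏ i ∈ Finset.univ.filter (fun i : Fin d => (i : ℕ) < k), x i

/-- Log-majorization `x ≺_log y`. -/
def LogMaj {d : ℕ} (x y : Fin d → ℝ) : Prop :=
  ∃ σ τ : Equiv.Perm (Fin d), Antitone (x ∘ σ) ∧ Antitone (y ∘ τ) ∧
    (∀ k < d, pprodd (x ∘ σ) k ≤ pprodd (y ∘ τ) k) ∧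
    pprodd (x ∘ σ) d = pprodd (y ∘ τ) d

/-- `μ` is the non-increasingly ordered eigenvalue list of the Hermitian matrix `A`. -/
def IsEigListM {d : ℕ} (A : Matrix (Fin d) (Fin d) ℂ) (μ : Fin d → ℝ) : Prop :=
  Antitone μ ∧ ∃ (hA : A.IsHermitian) (σ : Equiv.Perm (Fin d)),
    ∀ i, μ i = hA.eigenvalues (σ i)

/-- `U diag(m) Uᴴ`. -/
def UD {d : ℕ} (U : Matrix (Fin d) (Fin d) ℂ) (m : Fin d → ℝ) : Matrix (Fin d) (Fin d) ℂ :=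
  U * diagonal (fun i => (m i : ℂ)) * Uᴴ


section helpers

variable {d : ℕ}

lemma ud_mul {U : Matrix (Fin d) (Fin d) ℂ} (hU : Uᴴ * U = 1) (a b : Fin d → ℝ) :
    UD U a * UD U b = UD U (fun i => a i * b i) := by
  unfold UD
  have : U * diagonal (fun i => (a i : ℂ)) * Uᴴ * (U * diagonal (fun i => (b i : ℂ)) * Uᴴ)
      = U * (diagonal (fun i => (a i : ℂ)) * (Uᴴ * U) * diagonal (fun i => (b i : ℂ))) * Uᴴ := by
    simp only [Matrix.mul_assoc]
  rw [this, hU, Matrix.mul_one, diagonal_mul_diagonal]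
  simp

lemma ud_charpoly {U : Matrix (Fin d) (Fin d) ℂ} (hU : Uᴴ * U = 1) (a : Fin d → ℝ) :
    (UD U a).charpoly = ∏ i, (Polynomial.X - Polynomial.C (a i : ℂ)) := by
  unfold UD
  rw [charpoly_mul_comm, ← Matrix.mul_assoc, hU, Matrix.one_mul, charpoly_diagonal]

lemma ud_det {U : Matrix (Fin d) (Fin d) ℂ} (hU : Uᴴ * U = 1) (a : Fin d → ℝ) :
    (UD U a).det = ((∏ i, a i : ℝ) : ℂ) := by
  unfold UD
  rw [det_mul_comm, ← Matrix.mul_assoc, hU, Matrix.one_mul, det_diagonal]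
  simp

lemma ud_trace {U : Matrix (Fin d) (Fin d) ℂ} (hU : Uᴴ * U = 1) (a : Fin d → ℝ) :
    (UD U a).trace = ((∑ i, a i : ℝ) : ℂ) := by
  unfold UD
  rw [trace_mul_comm, ← Matrix.mul_assoc, hU, Matrix.one_mul, trace_diagonal]
  simp

lemma ud_one {U : Matrix (Fin d) (Fin d) ℂ} (hU : Uᴴ * U = 1) :
    UD U (fun _ => 1) = 1 := by
  unfold UD
  simp [mul_eq_one_comm.mp hU]

lemma ud_sub (U : Matrix (Fin d) (Fin d) ℂ) (a b : Fin d → ℝ) :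
    UD U a - UD U b = UD U (fun i => a i - b i) := by
  unfold UD
  rw [← Matrix.sub_mul, ← Matrix.mul_sub, diagonal_sub]
  simp

lemma ud_smul (U : Matrix (Fin d) (Fin d) ℂ) (a : Fin d → ℝ) (c : ℝ) :
    (c : ℂ) • UD U a = UD U (fun i => c * a i) := by
  unfold UD
  rw [← Matrix.smul_mul, ← Matrix.mul_smul, ← diagonal_smul]
  congr 3
  ext i
  simp

lemma ud_neg (U : Matrix (Fin d) (Fin d) ℂ) (a : Fin d → ℝ) :
    - UD U a = UD U (fun i => - a i) := by
  have := ud_smul U a (-1)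
  simpa using this

lemma ud_herm (U : Matrix (Fin d) (Fin d) ℂ) (a : Fin d → ℝ) : (UD U a).IsHermitian := by
  unfold UD
  apply isHermitian_mul_mul_conjTranspose
  rw [IsHermitian, diagonal_conjTranspose]
  congr 1
  ext i
  simp

lemma ud_psd (U : Matrix (Fin d) (Fin d) ℂ) {a : Fin d → ℝ} (h : ∀ i, 0 ≤ a i) :
    (UD U a).PosSemidef := by
  unfold UD
  apply PosSemidef.mul_mul_conjTranspose_same
  rw [posSemidef_diagonal_iff]
  intro i
  exact_mod_cast h i

lemma perm_unitary {U : Matrix (Fin d) (Fin d) ℂ} (hU : Uᴴ * U = 1) (σ : Equiv.Perm (Fin d)) :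
    (U.submatrix id σ)ᴴ * (U.submatrix id σ) = 1 := by
  have := submatrix_mul_equiv Uᴴ U σ (Equiv.refl _) σ
  rw [hU, submatrix_one_equiv] at this
  rw [conjTranspose_submatrix]
  exact this

lemma ud_perm (U : Matrix (Fin d) (Fin d) ℂ) (a : Fin d → ℝ) (σ : Equiv.Perm (Fin d)) :
    UD U a = UD (U.submatrix id σ) (a ∘ σ) := by
  unfold UD
  have : diagonal (fun i => ((a ∘ σ) i : ℂ)) = (diagonal (fun i => (a i : ℂ))).submatrix σ σ := by
    simp [submatrix_diagonal_equiv, Function.comp_def]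
  rw [this, conjTranspose_submatrix, submatrix_mul_equiv, submatrix_mul_equiv]
  simp

lemma ud_sum (U : Matrix (Fin d) (Fin d) ℂ) (a : Fin d → ℝ) :
    UD U a = ∑ i, (a i : ℂ) • vecMulVec (fun j => U j i) (star (fun j => U j i)) := by
  ext j k
  rw [UD, Matrix.mul_apply]
  simp only [mul_diagonal, Matrix.sum_apply, Matrix.smul_apply,
    vecMulVec_apply, conjTranspose_apply, Pi.star_apply, smul_eq_mul]
  refine Finset.sum_congr rfl fun i _ => by ring

lemma exists_antitone_perm (a : Fin d → ℝ) : ∃ σ : Equiv.Perm (Fin d), Antitone (a ∘ σ) := by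
  refine ⟨Tuple.sort (fun i => - a i), fun i j hij => ?_⟩
  have := Tuple.monotone_sort (fun i => - a i) hij
  simpa using this

lemma exists_perm_of_prod {a b : Fin d → ℝ}
    (h : ∏ i, (Polynomial.X - Polynomial.C (a i : ℂ)) = ∏ i, (Polynomial.X - Polynomial.C (b i : ℂ))) :
    ∃ σ : Equiv.Perm (Fin d), a = b ∘ σ := by
  have key : ∀ c : Fin d → ℝ, (∏ i, (Polynomial.X - Polynomial.C (c i : ℂ))).roots
      = (Finset.univ.val.map c).map (fun r : ℝ => (r : ℂ)) := by
    intro c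
    have := Polynomial.roots_multiset_prod_X_sub_C
      ((Finset.univ.val.map c).map (fun r : ℝ => (r : ℂ)))
    rw [← this]
    simp [Finset.prod_eq_multiset_prod, Function.comp_def]
  have h2 := congrArg Polynomial.roots h
  rw [key, key] at h2
  have h3 := Multiset.map_injective Complex.ofReal_injective h2
  rw [Fin.univ_val_map, Fin.univ_val_map, Multiset.coe_eq_coe] at h3
  obtain ⟨σ, hσ⟩ := exists_antitone_perm a
  obtain ⟨τ, hτ⟩ := exists_antitone_perm b
  have h4 : a ∘ σ = b ∘ τ := List.ofFn_injective <|
    (((σ.ofFn_comp_perm a).trans h3).trans (τ.ofFn_comp_perm b).symm).eq_of_pairwise'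
      hσ.sortedGE_ofFn.pairwise hτ.sortedGE_ofFn.pairwise
  refine ⟨σ⁻¹.trans τ, ?_⟩
  ext i
  have := congrFun h4 (σ⁻¹ i)
  simpa using this

lemma exists_ud_of_charpoly {A : Matrix (Fin d) (Fin d) ℂ} (hA : A.IsHermitian) {a : Fin d → ℝ}
    (h : A.charpoly = ∏ i, (Polynomial.X - Polynomial.C (a i : ℂ))) :
    ∃ U : Matrix (Fin d) (Fin d) ℂ, Uᴴ * U = 1 ∧ A = UD U a := by
  obtain ⟨σ, hσ⟩ := exists_perm_of_prod (h.symm.trans hA.charpoly_eq)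
  have h1 : A = UD (hA.eigenvectorUnitary : Matrix (Fin d) (Fin d) ℂ) hA.eigenvalues :=
    hA.spectral_theorem
  have hU : (hA.eigenvectorUnitary : Matrix (Fin d) (Fin d) ℂ)ᴴ * hA.eigenvectorUnitary = 1 :=
    Unitary.coe_star_mul_self _
  refine ⟨_, perm_unitary hU σ, ?_⟩
  rw [hσ, ← ud_perm]
  exact h1

lemma exists_ud {A : Matrix (Fin d) (Fin d) ℂ} (hA : A.IsHermitian) :
    ∃ (U : Matrix (Fin d) (Fin d) ℂ) (a : Fin d → ℝ), Antitone a ∧ Uᴴ * U = 1 ∧ A = UD U a := by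
  have h1 : A = UD (hA.eigenvectorUnitary : Matrix (Fin d) (Fin d) ℂ) hA.eigenvalues :=
    hA.spectral_theorem
  have hU : (hA.eigenvectorUnitary : Matrix (Fin d) (Fin d) ℂ)ᴴ * hA.eigenvectorUnitary = 1 :=
    Unitary.coe_star_mul_self _
  obtain ⟨σ, hσ⟩ := exists_antitone_perm hA.eigenvalues
  exact ⟨_, _, hσ, perm_unitary hU σ, h1.trans (ud_perm _ _ σ)⟩

lemma antitone_eq_of_perm {a b : Fin d → ℝ} (ha : Antitone a) (hb : Antitone b)
    {σ : Equiv.Perm (Fin d)} (h : a = b ∘ σ) : a = b := by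
  have := Tuple.unique_antitone (f := b) (σ := σ) (τ := 1) (by rwa [← h]) (by simpa using hb)
  rw [h, this]; simp

lemma ud_unique {U U' : Matrix (Fin d) (Fin d) ℂ} (hU : Uᴴ * U = 1) (hU' : U'ᴴ * U' = 1)
    {a b : Fin d → ℝ} (ha : Antitone a) (hb : Antitone b)
    (h : (UD U a).charpoly = (UD U' b).charpoly) : a = b := by
  rw [ud_charpoly hU, ud_charpoly hU'] at h
  obtain ⟨σ, hσ⟩ := exists_perm_of_prod h
  exact antitone_eq_of_perm ha hb hσ

lemma ud_quad (U : Matrix (Fin d) (Fin d) ℂ) (a : Fin d → ℝ) (x : Fin d → ℂ) :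
    star x ⬝ᵥ (UD U a *ᵥ x) = ((∑ j, a j * ‖(Uᴴ *ᵥ x) j‖ ^ 2 : ℝ) : ℂ) := by
  unfold UD
  rw [← mulVec_mulVec, ← mulVec_mulVec, dotProduct_mulVec]
  have : star x ᵥ* U = star (Uᴴ *ᵥ x) := by
    rw [star_mulVec, conjTranspose_conjTranspose]
  rw [this]
  simp only [dotProduct, mulVec_diagonal, Pi.star_apply]
  push_cast
  refine Finset.sum_congr rfl fun j _ => ?_
  rw [← Complex.mul_conj', Complex.star_def]
  ring

lemma weyl {U U' : Matrix (Fin d) (Fin d) ℂ} (hU : Uᴴ * U = 1) (hU' : U'ᴴ * U' = 1)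
    {a b : Fin d → ℝ} (ha : Antitone a) (hb : Antitone b)
    (h : (UD U' b - UD U a).PosSemidef) (i : Fin d) : a i ≤ b i := by
  let N : Matrix (Fin d) (Fin d) ℂ := fun j k =>
    if j < i then (U'ᴴ * U) j k else if i < j then (1 : Matrix (Fin d) (Fin d) ℂ) j k else 0
  have hN : N.det = 0 := det_eq_zero_of_row_eq_zero i (by intro j; simp [N])
  obtain ⟨c, hc0, hc⟩ := exists_mulVec_eq_zero_iff.mpr hN
  have h1 : ∀ j, i < j → c j = 0 := by
    intro j hj
    have := congrFun hc j
    have hrow : N j = (1 : Matrix (Fin d) (Fin d) ℂ) j := by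
      ext k; simp [N, hj, not_lt.mpr hj.le]
    have e : (N *ᵥ c) j = ((1 : Matrix (Fin d) (Fin d) ℂ) *ᵥ c) j := by
      simp only [mulVec, hrow]
    rw [e, one_mulVec] at this
    simpa using this
  have h2 : ∀ j, j < i → ((U'ᴴ * U) *ᵥ c) j = 0 := by
    intro j hj
    have := congrFun hc j
    have hrow : N j = (U'ᴴ * U) j := by
      ext k; simp [N, hj]
    have e : (N *ᵥ c) j = ((U'ᴴ * U) *ᵥ c) j := by
      simp only [mulVec, hrow]
    rw [e] at this
    simpa using this
  have hq := h.dotProduct_mulVec_nonneg (U *ᵥ c)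
  rw [sub_mulVec, dotProduct_sub, ud_quad, ud_quad] at hq
  have e1 : Uᴴ *ᵥ (U *ᵥ c) = c := by rw [mulVec_mulVec, hU, one_mulVec]
  rw [e1, mulVec_mulVec] at hq
  have hn1 := ud_quad U (fun _ => 1) (U *ᵥ c)
  have hn2 := ud_quad U' (fun _ => 1) (U *ᵥ c)
  rw [ud_one hU, e1] at hn1
  rw [ud_one hU', hn1, mulVec_mulVec] at hn2
  set e := (U'ᴴ * U) *ᵥ c
  have hn : ∑ j, ‖c j‖ ^ 2 = ∑ j, ‖e j‖ ^ 2 := by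
    have := Complex.ofReal_injective hn2
    simpa using this
  have hq' : ∑ j, a j * ‖c j‖ ^ 2 ≤ ∑ j, b j * ‖e j‖ ^ 2 := by
    rw [← Complex.ofReal_sub] at hq
    have := Complex.zero_le_real.mp hq
    linarith
  have hpos : 0 < ∑ j, ‖c j‖ ^ 2 := by
    obtain ⟨j, hj⟩ := Function.ne_iff.mp hc0
    refine Finset.sum_pos' (fun _ _ => by positivity) ⟨j, Finset.mem_univ _, ?_⟩
    have : 0 < ‖c j‖ := norm_pos_iff.mpr hj
    positivity
  have l1 : a i * ∑ j, ‖c j‖ ^ 2 ≤ ∑ j, a j * ‖c j‖ ^ 2 := by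
    rw [Finset.mul_sum]
    refine Finset.sum_le_sum fun j _ => ?_
    rcases le_or_gt j i with hj | hj
    · exact mul_le_mul_of_nonneg_right (ha hj) (by positivity)
    · simp [h1 j hj]
  have l2 : ∑ j, b j * ‖e j‖ ^ 2 ≤ b i * ∑ j, ‖e j‖ ^ 2 := by
    rw [Finset.mul_sum]
    refine Finset.sum_le_sum fun j _ => ?_
    rcases lt_or_ge j i with hj | hj
    · simp [h2 j hj]
    · exact mul_le_mul_of_nonneg_right (hb hj) (by positivity)
  rw [← hn] at l2
  exact le_of_mul_le_mul_right (l1.trans (hq'.trans l2)) hpos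

lemma root_unique {M N : Matrix (Fin d) (Fin d) ℂ} (hM : M.PosSemidef) (hN : N.PosSemidef)
    (h : M * M = N * N) : M = N := by
  open scoped MatrixOrder Matrix.Norms.L2Operator in
  exact ((CFC.sqrt_unique h (nonneg_iff_posSemidef.mpr hM)).symm).trans
    (CFC.sqrt_unique rfl (nonneg_iff_posSemidef.mpr hN))

lemma lidskii {X W U1 U2 U3 : Matrix (Fin d) (Fin d) ℂ} (hU1 : U1ᴴ * U1 = 1) (hU2 : U2ᴴ * U2 = 1)
    (hU3 : U3ᴴ * U3 = 1) {x y z : Fin d → ℝ} (hx : Antitone x) (hy : Antitone y) (hz : Antitone z)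
    (hx0 : ∀ i, 0 < x i) (hy0 : ∀ i, 0 < y i)
    (hX : X = UD U1 x) (hY : Wᴴ * W = UD U2 y) (hZ : W * X * Wᴴ = UD U3 z)
    (J : Finset (Fin d)) :
    ∏ i ∈ J, z i ≤ (∏ i ∈ J, x i) * pprodd y J.card := by
  rcases J.eq_empty_or_nonempty with rfl | hJ
  · simp [pprodd]
  have hk0 : 0 < J.card := hJ.card_pos
  have hkd : J.card ≤ d := by simpa using J.card_le_univ
  set k := J.card with hk
  set c := y ⟨k - 1, by omega⟩ with hc
  have hc0 : 0 < c := hy0 _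
  set H := UD U1 (fun i => Real.sqrt (x i)) with hH
  have hHH : H * H = X := by
    rw [hH, ud_mul hU1, hX]
    congr 1; ext i; exact Real.mul_self_sqrt (hx0 i).le
  have hHh : Hᴴ = H := ud_herm _ _
  set Z' := H * UD U2 (fun i => max (y i) c) * Hᴴ with hZ'
  have hZ'h : Z'.IsHermitian := isHermitian_mul_mul_conjTranspose _ (ud_herm _ _)
  obtain ⟨U4, z', hz', hU4, hZ4⟩ := exists_ud hZ'h
  have hcp : (H * UD U2 y * Hᴴ).charpoly = (W * X * Wᴴ).charpoly := by
    rw [← hY, hHh, ← hHH, show H * (Wᴴ * W) * H = (H * Wᴴ) * (W * H) by simp only [Matrix.mul_assoc],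
      charpoly_mul_comm]
    simp only [Matrix.mul_assoc]
  rw [hZ, ud_charpoly hU3] at hcp
  obtain ⟨U5, hU5, hZ5⟩ := exists_ud_of_charpoly
    (isHermitian_mul_mul_conjTranspose _ (ud_herm _ _)) hcp
  have hz0 : ∀ i, 0 ≤ z i := by
    refine weyl (a := fun _ => 0) hU1 hU5 (fun _ _ _ => le_rfl) hz ?_
    rw [← hZ5]
    have : UD U1 (fun _ => 0) = 0 := by simp [UD]
    rw [this, sub_zero]
    exact (ud_psd U2 (fun i => (hy0 i).le)).mul_mul_conjTranspose_same _
  have hzz' : ∀ i, z i ≤ z' i := by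
    refine weyl hU5 hU4 hz hz' ?_
    rw [← hZ5, ← hZ4, hZ', ← Matrix.sub_mul, ← Matrix.mul_sub, ud_sub]
    exact (ud_psd U2 (fun i => by simp)).mul_mul_conjTranspose_same _
  have hxz' : ∀ i, c * x i ≤ z' i := by
    refine weyl hU1 hU4 (fun i j hij => mul_le_mul_of_nonneg_left (hx hij) hc0.le) hz' ?_
    have : UD U1 (fun i => c * x i) = H * UD U2 (fun _ => c * 1) * Hᴴ := by
      rw [← ud_smul, ← hX, ← ud_smul, ud_one hU2, hHh, ← hHH]
      simp
    rw [this, ← hZ4, hZ', ← Matrix.sub_mul, ← Matrix.mul_sub, ud_sub]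
    exact (ud_psd U2 (fun i => by simp)).mul_mul_conjTranspose_same _
  have hdet : ∏ i, z' i = (∏ i, x i) * ∏ i, max (y i) c := by
    have h1 : Z'.det = X.det * (UD U2 (fun i => max (y i) c)).det := by
      rw [hZ', hHh, ← hHH]
      simp only [det_mul]; ring
    rw [hZ4, hX, ud_det hU4, ud_det hU1, ud_det hU2, ← Complex.ofReal_mul] at h1
    exact Complex.ofReal_injective h1
  have hcard : (Finset.univ.filter (fun i : Fin d => ¬ (i : ℕ) < k)).card = Jᶜ.card := by
    have h1 := Finset.card_filter_add_card_filter_not (s := (Finset.univ : Finset (Fin d)))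
      (fun i : Fin d => (i : ℕ) < k)
    have h2 := J.card_add_card_compl
    have h3 : (Finset.univ.filter (fun i : Fin d => (i : ℕ) < k)).card = k := by
      rw [Fin.card_filter_val_lt]; omega
    simp only [Finset.card_univ, Fintype.card_fin] at h1 h2
    omega
  have hmax : ∏ i, max (y i) c = pprodd y k * c ^ Jᶜ.card := by
    rw [← Finset.prod_filter_mul_prod_filter_not Finset.univ (fun i : Fin d => (i : ℕ) < k), pprodd]
    congr 1
    · refine Finset.prod_congr rfl fun i hi => max_eq_left (hy ?_)
      have := (Finset.mem_filter.mp hi).2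
      exact Fin.le_def.mpr (by simp; omega)
    · rw [← hcard, ← Finset.prod_const]
      refine Finset.prod_congr rfl fun i hi => max_eq_right (hy ?_)
      have := (Finset.mem_filter.mp hi).2
      exact Fin.le_def.mpr (by simp; omega)
  have hcx : ∀ i, 0 < c * x i := fun i => mul_pos hc0 (hx0 i)
  have h1 : (∏ i ∈ J, z i) * ∏ i ∈ Jᶜ, (c * x i) ≤ ∏ i, z' i := by
    rw [← Finset.prod_mul_prod_compl J]
    refine mul_le_mul (Finset.prod_le_prod (fun i _ => hz0 i) fun i _ => hzz' i)
      (Finset.prod_le_prod (fun i _ => (hcx i).le) fun i _ => hxz' i)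
      (Finset.prod_nonneg fun i _ => (hcx i).le)
      (Finset.prod_nonneg fun i _ => (hz0 i).trans (hzz' i))
  have hP : 0 < ∏ i ∈ Jᶜ, (c * x i) := Finset.prod_pos fun i _ => hcx i
  refine le_of_mul_le_mul_right (h1.trans (le_of_eq ?_)) hP
  rw [hdet, hmax, ← Finset.prod_mul_prod_compl J, Finset.prod_mul_distrib, Finset.prod_const]
  ring

lemma ds_le {p q : Fin d → ℝ} (hp : Antitone p) (hq : Antitone q) {D : Matrix (Fin d) (Fin d) ℝ}
    (hD : D ∈ doublyStochastic ℝ (Fin d)) :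
    ∑ i, ∑ j, D i j * (p i * q j) ≤ ∑ i, p i * q i := by
  obtain ⟨w, hw0, hw1, rfl⟩ := exists_eq_sum_perm_of_mem_doublyStochastic hD
  have hmv : Monovary p q := hp.monovary hq
  calc ∑ i, ∑ j, (∑ σ : Equiv.Perm (Fin d), w σ • σ.permMatrix ℝ) i j * (p i * q j)
      = ∑ σ : Equiv.Perm (Fin d), w σ * ∑ i, p i * q (σ i) := by
        simp only [Matrix.sum_apply, Finset.sum_mul, Finset.mul_sum, Matrix.smul_apply, smul_eq_mul]
        rw [Finset.sum_comm' (t' := Finset.univ) (s' := fun _ => Finset.univ) (by simp)]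
        conv_lhs => 
          enter [2, j]
          rw [Finset.sum_comm]
        rw [Finset.sum_comm]
        refine Finset.sum_congr rfl fun σ _ => ?_
        rw [Finset.sum_comm]
        refine Finset.sum_congr rfl fun i _ => ?_
        rw [Finset.sum_eq_single (σ i)]
        · simp [Equiv.Perm.permMatrix]
        · intro j _ hj
          simp [Equiv.Perm.permMatrix, PEquiv.toMatrix_apply, hj.symm]
        · simp
    _ ≤ ∑ σ : Equiv.Perm (Fin d), w σ * ∑ i, p i * q i :=
        Finset.sum_le_sum fun σ _ => mul_le_mul_of_nonneg_left
          hmv.sum_mul_comp_perm_le_sum_mul (hw0 σ)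
    _ = ∑ i, p i * q i := by rw [← Finset.sum_mul, hw1, one_mul]

lemma ds_support {p q : Fin d → ℝ} (hp : Antitone p) (hq : Antitone q)
    {D : Matrix (Fin d) (Fin d) ℝ} (hD : D ∈ doublyStochastic ℝ (Fin d))
    (heq : ∑ i, ∑ j, D i j * (p i * q j) = ∑ i, p i * q i) {i k j l : Fin d}
    (h1 : p k < p i) (h2 : q j < q l) : D i j = 0 ∨ D k l = 0 := by
  by_contra hcon
  push Not at hcon
  obtain ⟨hr, hrow, hcol⟩ := mem_doublyStochastic_iff_sum.mp hD
  have hik : i ≠ k := by rintro rfl; exact lt_irrefl _ h1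
  have hjl : j ≠ l := by rintro rfl; exact lt_irrefl _ h2
  obtain ⟨ε, hε0, e1, e2⟩ : ∃ ε : ℝ, 0 < ε ∧ ε ≤ D i j ∧ ε ≤ D k l :=
    ⟨min (D i j) (D k l), lt_min (lt_of_le_of_ne (hr _ _) hcon.1.symm)
      (lt_of_le_of_ne (hr _ _) hcon.2.symm), min_le_left _ _, min_le_right _ _⟩
  let f : Fin d → ℝ := fun a => (if a = i then 1 else 0) - (if a = k then 1 else 0)
  let g : Fin d → ℝ := fun b => (if b = l then 1 else 0) - (if b = j then 1 else 0)
  let D' : Matrix (Fin d) (Fin d) ℝ := fun a b => D a b + ε * (f a * g b)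
  have hf : ∑ a, f a = 0 := by simp [f]
  have hg : ∑ a, g a = 0 := by simp [g]
  have hD' : D' ∈ doublyStochastic ℝ (Fin d) := by
    rw [mem_doublyStochastic_iff_sum]
    refine ⟨fun a b => ?_, fun a => ?_, fun b => ?_⟩
    · have := hr a b
      simp only [D', f, g]
      have e1' : a = i → b = j → ε ≤ D a b := by rintro rfl rfl; exact e1
      have e2' : a = k → b = l → ε ≤ D a b := by rintro rfl rfl; exact e2
      have e3 : a = i → a = k → False := fun h h' => hik (h.symm.trans h')
      have e4 : b = j → b = l → False := fun h h' => hjl (h.symm.trans h')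
      by_cases ha : a = i <;> by_cases ha' : a = k <;> by_cases hb : b = j <;> by_cases hb' : b = l
        <;> simp only [ha, ha', hb, hb', if_true, if_false] <;>
        first
          | exact (e3 ha ha').elim
          | exact (e4 hb hb').elim
          | (have := e1' ha hb; subst ha; subst hb; simp [hik, hjl]; linarith)
          | (have := e2' ha' hb'; subst ha'; subst hb'; simp [hik.symm, hjl.symm]; linarith)
          | (subst_vars; simp [*]; try linarith)
    · simp only [D', Finset.sum_add_distrib, ← Finset.mul_sum, hg, hrow]; simp
    · simp only [D', Finset.sum_add_distrib, ← Finset.mul_sum, ← Finset.sum_mul, hf, hcol]; simp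
  have hle := ds_le hp hq hD'
  have hpf : ∑ a, f a * p a = p i - p k := by simp [f, sub_mul]
  have hqg : ∑ a, g a * q a = q l - q j := by simp [g, sub_mul]
  have : ∑ a, ∑ b, D' a b * (p a * q b) = ∑ a, p a * q a + ε * ((p i - p k) * (q l - q j)) := by
    rw [← heq, ← hpf, ← hqg, Finset.sum_mul_sum, Finset.mul_sum, ← Finset.sum_add_distrib]
    refine Finset.sum_congr rfl fun a _ => ?_
    rw [Finset.mul_sum, ← Finset.sum_add_distrib]
    refine Finset.sum_congr rfl fun b _ => ?_
    simp only [D']; ring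
  have : 0 < ε * ((p i - p k) * (q l - q j)) :=
    mul_pos hε0 (mul_pos (by linarith) (by linarith))
  linarith

lemma joint_diag {P Q : Matrix (Fin d) (Fin d) ℂ} (hP : P.IsHermitian) (hQ : Q.IsHermitian)
    (hPQ : P * Q = Q * P) :
    ∃ (U : Matrix (Fin d) (Fin d) ℂ) (a c : Fin d → ℝ), Uᴴ * U = 1 ∧ P = UD U a ∧ Q = UD U c := by
  have sP := isSymmetric_toEuclideanLin_iff.mpr hP
  have sQ := isSymmetric_toEuclideanLin_iff.mpr hQ
  have hcomm : Commute (toEuclideanLin P) (toEuclideanLin Q) := by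
    change toEuclideanLin P * toEuclideanLin Q = toEuclideanLin Q * toEuclideanLin P
    apply LinearMap.ext
    intro x
    simp [toLpLin_apply, Module.End.mul_apply, hPQ]
  have hdec0 := LinearMap.IsSymmetric.directSum_isInternal_of_commute sP sQ hcomm
  have horth0 := LinearMap.IsSymmetric.orthogonalFamily_eigenspace_inf_eigenspace sP sQ
  have hfin := WellFoundedGT.finite_ne_bot_of_iSupIndep horth0.independent
  have hdec := DirectSum.isInternal_ne_bot_iff.mpr hdec0
  have hfin' : Finite {i : ℂ × ℂ // Module.End.eigenspace (toEuclideanLin P) i.2 ⊓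
    Module.End.eigenspace (toEuclideanLin Q) i.1 ≠ ⊥} := hfin.to_subtype
  let ft := Fintype.ofFinite {i : ℂ × ℂ // Module.End.eigenspace (toEuclideanLin P) i.2 ⊓
    Module.End.eigenspace (toEuclideanLin Q) i.1 ≠ ⊥}
  have horth := horth0.comp (Subtype.val_injective (p := fun i : ℂ × ℂ =>
    Module.End.eigenspace (toEuclideanLin P) i.2 ⊓
    Module.End.eigenspace (toEuclideanLin Q) i.1 ≠ ⊥))
  have hn : Module.finrank ℂ (EuclideanSpace ℂ (Fin d)) = d := by simp
  let b := hdec.subordinateOrthonormalBasis hn horth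
  have hb := fun i => hdec.subordinateOrthonormalBasis_subordinate hn i horth
  let idx := fun i => hdec.subordinateOrthonormalBasisIndex hn i horth
  have hbP : ∀ i, P *ᵥ (b i).ofLp = (idx i).1.2 • (b i).ofLp := by
    intro i
    have := Module.End.mem_eigenspace_iff.mp (hb i).1
    simpa [toLpLin_apply] using congrArg WithLp.ofLp this
  have hbQ : ∀ i, Q *ᵥ (b i).ofLp = (idx i).1.1 • (b i).ofLp := by
    intro i
    have := Module.End.mem_eigenspace_iff.mp (hb i).2
    simpa [toLpLin_apply] using congrArg WithLp.ofLp this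
  let U : Matrix (Fin d) (Fin d) ℂ := of fun j i => b i j
  have hU : Uᴴ * U = 1 := by
    ext i j
    have := orthonormal_iff_ite.mp b.orthonormal i j
    rw [EuclideanSpace.inner_eq_star_dotProduct, dotProduct_comm] at this
    rw [Matrix.mul_apply]
    simpa [U, dotProduct, Matrix.one_apply] using this
  have hUU : U * Uᴴ = 1 := mul_eq_one_comm.mp hU
  have gen : ∀ (R : Matrix (Fin d) (Fin d) ℂ) (α : Fin d → ℂ), R.IsHermitian →
      (∀ i, R *ᵥ (b i).ofLp = α i • (b i).ofLp) → ∃ a : Fin d → ℝ, R = UD U a := by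
    intro R α hR h
    have h1 : R * U = U * diagonal α := by
      ext j i
      have := congrFun (h i) j
      rw [mul_diagonal, Matrix.mul_apply]
      simpa [mulVec, dotProduct, U, mul_comm] using this
    have h2 : Uᴴ * R * U = diagonal α := by
      rw [Matrix.mul_assoc, h1, ← Matrix.mul_assoc, hU, Matrix.one_mul]
    have h3 : (diagonal α)ᴴ = diagonal α := by
      rw [← h2]; exact isHermitian_conjTranspose_mul_mul _ hR
    rw [diagonal_conjTranspose] at h3
    have h4 := diagonal_injective h3
    refine ⟨fun i => (α i).re, ?_⟩
    have h5 : (fun i => (((α i).re : ℝ) : ℂ)) = α := by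
      ext i
      exact Complex.conj_eq_iff_re.mp (congrFun h4 i)
    rw [UD, h5, ← h1, Matrix.mul_assoc, hUU, Matrix.mul_one]
  obtain ⟨a, ha⟩ := gen P _ hP hbP
  obtain ⟨c, hc⟩ := gen Q _ hQ hbQ
  exact ⟨U, a, c, hU, ha, hc⟩

lemma vn_commute {U1 U2 : Matrix (Fin d) (Fin d) ℂ} (hU1 : U1ᴴ * U1 = 1) (hU2 : U2ᴴ * U2 = 1)
    {p q : Fin d → ℝ} (hp : Antitone p) (hq : Antitone q)
    (h : (UD U1 p * UD U2 q).trace = ((∑ i, p i * q i : ℝ) : ℂ)) :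
    UD U1 p * UD U2 q = UD U2 q * UD U1 p := by
  have hU1' : U1 * U1ᴴ = 1 := mul_eq_one_comm.mp hU1
  have hU2' : U2 * U2ᴴ = 1 := mul_eq_one_comm.mp hU2
  set T := U1ᴴ * U2 with hT
  have hT1 : Tᴴ * T = 1 := by
    rw [hT, conjTranspose_mul, conjTranspose_conjTranspose, Matrix.mul_assoc,
      ← Matrix.mul_assoc U1, hU1', Matrix.one_mul, hU2]
  have hT2 : T * Tᴴ = 1 := mul_eq_one_comm.mp hT1
  set G := UD T q with hG
  set E := diagonal (fun i => (p i : ℂ)) with hE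
  have e1 : UD U2 q = U1 * G * U1ᴴ := by
    have : U2 = U1 * T := by rw [hT, ← Matrix.mul_assoc, hU1', Matrix.one_mul]
    rw [hG, this]
    simp only [UD, conjTranspose_mul, Matrix.mul_assoc]
  have e2 : UD U1 p * UD U2 q = U1 * (E * G) * U1ᴴ := by
    rw [e1, UD, show U1 * E * U1ᴴ * (U1 * G * U1ᴴ) = U1 * (E * (U1ᴴ * U1) * G) * U1ᴴ by
      simp only [Matrix.mul_assoc], hU1, Matrix.mul_one]
  have e3 : UD U2 q * UD U1 p = U1 * (G * E) * U1ᴴ := by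
    rw [e1, UD, show U1 * G * U1ᴴ * (U1 * E * U1ᴴ) = U1 * (G * (U1ᴴ * U1) * E) * U1ᴴ by
      simp only [Matrix.mul_assoc], hU1, Matrix.mul_one]
  have hGapp : ∀ i k, G i k = ∑ j, (q j : ℂ) * (T i j * star (T k j)) := by
    intro i k
    rw [hG, UD, Matrix.mul_apply]
    refine Finset.sum_congr rfl fun j _ => ?_
    rw [mul_diagonal, conjTranspose_apply]; ring
  let D : Matrix (Fin d) (Fin d) ℝ := fun i j => ‖T i j‖ ^ 2
  have hDc : ∀ i j, (D i j : ℂ) = T i j * star (T i j) := by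
    intro i j
    simp only [D]
    rw [Complex.star_def, Complex.mul_conj']; push_cast; rfl
  have hDS : D ∈ doublyStochastic ℝ (Fin d) := by
    rw [mem_doublyStochastic_iff_sum]
    refine ⟨fun i j => by simp only [D]; positivity, fun i => ?_, fun j => ?_⟩
    · apply Complex.ofReal_injective
      have := congrFun (congrFun hT2 i) i
      rw [Matrix.mul_apply] at this
      push_cast
      simp only [hDc]
      simpa using this
    · apply Complex.ofReal_injective
      have := congrFun (congrFun hT1 j) j
      rw [Matrix.mul_apply] at this
      push_cast
      simp only [hDc]
      simpa [mul_comm] using this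
  have heq : ∑ i, ∑ j, D i j * (p i * q j) = ∑ i, p i * q i := by
    apply Complex.ofReal_injective
    rw [← h, e2, trace_mul_comm, ← Matrix.mul_assoc, hU1, Matrix.one_mul, trace]
    push_cast
    refine Finset.sum_congr rfl fun i _ => ?_
    rw [diag_apply, hE, diagonal_mul, hGapp, Finset.mul_sum]
    refine Finset.sum_congr rfl fun j _ => ?_
    rw [hDc]; ring
  have hT0 : ∀ i j, D i j = 0 → T i j = 0 := by
    intro i j hij
    simpa [D] using hij
  have key : ∀ i k, p k < p i → G i k = 0 := by
    intro i k hik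
    have hne : i ≠ k := by rintro rfl; exact lt_irrefl _ hik
    by_cases hall : ∀ j, T i j * star (T k j) = 0
    · rw [hGapp]; simp only [hall]; simp
    · push Not at hall
      obtain ⟨j0, hj0⟩ := hall
      have hi0 : T i j0 ≠ 0 := left_ne_zero_of_mul hj0
      have hk0 : T k j0 ≠ 0 := by
        intro h0; apply hj0; simp [h0]
      have : ∀ j, (q j : ℂ) * (T i j * star (T k j)) = (q j0 : ℂ) * (T i j * star (T k j)) := by
        intro j
        by_cases hj : T i j * star (T k j) = 0
        · rw [hj]; simp
        have hi1 : T i j ≠ 0 := left_ne_zero_of_mul hj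
        have hk1 : T k j ≠ 0 := by
          intro h0; apply hj; simp [h0]
        rcases lt_trichotomy (q j) (q j0) with hlt | he | hgt
        · rcases ds_support hp hq hDS heq hik hlt with h' | h'
          · exact absurd (hT0 _ _ h') hi1
          · exact absurd (hT0 _ _ h') hk0
        · rw [he]
        · rcases ds_support hp hq hDS heq hik hgt with h' | h'
          · exact absurd (hT0 _ _ h') hi0
          · exact absurd (hT0 _ _ h') hk1
      rw [hGapp]
      simp only [this]
      rw [← Finset.mul_sum]
      have h3 := congrFun (congrFun hT2 i) k
      rw [Matrix.mul_apply] at h3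
      simp only [conjTranspose_apply, Matrix.one_apply, hne, if_false] at h3
      rw [h3, mul_zero]
  have hGh : G.IsHermitian := ud_herm _ _
  rw [e2, e3]
  congr 2
  ext i k
  rw [hE, diagonal_mul, mul_diagonal]
  rcases lt_trichotomy (p i) (p k) with hlt | he | hgt
  · have := key k i hlt
    rw [← hGh.apply i k, this]; simp
  · rw [he, mul_comm]
  · rw [key i k hgt]; simp

lemma vn_eq {U1 U2 : Matrix (Fin d) (Fin d) ℂ} (hU1 : U1ᴴ * U1 = 1) (hU2 : U2ᴴ * U2 = 1)
    {p q : Fin d → ℝ} (hp : Antitone p) (hq : Antitone q)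
    (h : (UD U1 p * UD U2 q).trace = ((∑ i, p i * q i : ℝ) : ℂ)) :
    ∃ U : Matrix (Fin d) (Fin d) ℂ, Uᴴ * U = 1 ∧ UD U1 p = UD U p ∧ UD U2 q = UD U q := by
  obtain ⟨U, a, c, hU, hPa, hQc⟩ := joint_diag (ud_herm U1 p) (ud_herm U2 q)
    (vn_commute hU1 hU2 hp hq h)
  obtain ⟨σ, hσ⟩ : ∃ σ : Equiv.Perm (Fin d), a = p ∘ σ := by
    apply exists_perm_of_prod
    rw [← ud_charpoly hU, ← hPa, ud_charpoly hU1]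
  obtain ⟨τ, hτ⟩ : ∃ σ : Equiv.Perm (Fin d), c = q ∘ σ := by
    apply exists_perm_of_prod
    rw [← ud_charpoly hU, ← hQc, ud_charpoly hU2]
  rw [hPa, hQc, ud_mul hU, ud_trace hU] at h
  have hs : ∑ i, a i * c i = ∑ i, p i * q i := Complex.ofReal_injective h
  have hmv : Monovary p (q ∘ (σ⁻¹.trans τ)) := by
    rw [← (hp.monovary hq).sum_mul_comp_perm_eq_sum_mul_iff, ← hs, hσ, hτ]
    rw [← Equiv.sum_comp σ]
    simp
  have hac : Monovary a c := by
    intro i j hij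
    have := hmv (i := σ i) (j := σ j) (by simpa [hτ] using hij)
    simpa [hσ] using this
  obtain ⟨ρ, hρ⟩ := exists_antitone_perm (fun i => a i + c i)
  have hm : ∀ i j, a j + c j ≤ a i + c i → a j ≤ a i ∧ c j ≤ c i := by
    intro i j hij
    rcases lt_trichotomy (c i) (c j) with h1 | h1 | h1
    · have := hac h1
      exact ⟨by linarith, by linarith⟩
    · exact ⟨by linarith, h1.ge⟩
    · exact ⟨hac h1, h1.le⟩
  have haρ : Antitone (a ∘ ρ) := fun i j hij => (hm _ _ (hρ hij)).1
  have hcρ : Antitone (c ∘ ρ) := fun i j hij => (hm _ _ (hρ hij)).2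
  have ha : a ∘ ρ = p := antitone_eq_of_perm haρ hp (σ := ρ.trans σ) (by rw [hσ]; rfl)
  have hc : c ∘ ρ = q := antitone_eq_of_perm hcρ hq (σ := ρ.trans τ) (by rw [hτ]; rfl)
  refine ⟨_, perm_unitary hU ρ, ?_, ?_⟩
  · rw [hPa, ← ha, ← ud_perm]
  · rw [hQc, ← hc, ← ud_perm]

lemma lidskii_eq {X W U1 U3 : Matrix (Fin d) (Fin d) ℂ} (hU1 : U1ᴴ * U1 = 1)
    (hU3 : U3ᴴ * U3 = 1) {x z : Fin d → ℝ} (hx : Antitone x) (hz : Antitone z)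
    (hx0 : ∀ i, 0 < x i)
    (hX : X = UD U1 x) (hZ : W * X * Wᴴ = UD U3 z)
    (htr : (Wᴴ * W).trace = ((∑ i, z i / x i : ℝ) : ℂ)) :
    ∃ U : Matrix (Fin d) (Fin d) ℂ, Uᴴ * U = 1 ∧ X = UD U x ∧
      Wᴴ * W = UD U (fun i => z i / x i) := by
  have hs0 : ∀ i, Real.sqrt (x i) ≠ 0 := fun i => (Real.sqrt_pos.mpr (hx0 i)).ne'
  have hss : ∀ i, Real.sqrt (x i) * Real.sqrt (x i) = x i := fun i => Real.mul_self_sqrt (hx0 i).le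
  set H := UD U1 (fun i => Real.sqrt (x i)) with hH
  set K := UD U1 (fun i => (Real.sqrt (x i))⁻¹) with hK
  have hHK : H * K = 1 := by
    rw [hH, hK, ud_mul hU1, ← ud_one hU1]
    congr 1; ext i; exact mul_inv_cancel₀ (hs0 i)
  have hKH : K * H = 1 := mul_eq_one_comm.mp hHK
  have hHH : H * H = X := by
    rw [hH, ud_mul hU1, hX]
    congr 1; ext i; exact hss i
  have hHh : Hᴴ = H := ud_herm _ _
  have hcp : (H * (Wᴴ * W) * Hᴴ).charpoly = (W * X * Wᴴ).charpoly := by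
    rw [hHh, ← hHH, show H * (Wᴴ * W) * H = (H * Wᴴ) * (W * H) by simp only [Matrix.mul_assoc],
      charpoly_mul_comm]
    simp only [Matrix.mul_assoc]
  rw [hZ, ud_charpoly hU3] at hcp
  obtain ⟨U5, hU5, hZ5⟩ := exists_ud_of_charpoly
    (isHermitian_mul_mul_conjTranspose _ (isHermitian_conjTranspose_mul_self W)) hcp
  rw [hHh] at hZ5
  have hKK : UD U1 (fun i => - (x i)⁻¹) = - (K * K) := by
    rw [← ud_neg, hK, ud_mul hU1]
    congr 2; ext i; rw [← mul_inv, hss]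
  have hanti : Antitone (fun i => - (x i)⁻¹) := by
    intro i j hij
    simp only [neg_le_neg_iff]
    exact inv_anti₀ (hx0 j) (hx hij)
  obtain ⟨U, hU, hA, hB⟩ := vn_eq hU1 hU5 hanti hz (by
    rw [hKK, ← hZ5]
    have : -(K * K) * (H * (Wᴴ * W) * H) = - (K * ((K * H) * (Wᴴ * W) * H)) := by
      simp only [Matrix.mul_assoc, Matrix.neg_mul]
    rw [this, hKH, Matrix.one_mul, trace_neg, trace_mul_comm, Matrix.mul_assoc, hHK, Matrix.mul_one,
      htr, ← Complex.ofReal_neg, ← Finset.sum_neg_distrib]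
    congr 1
    refine Finset.sum_congr rfl fun i _ => ?_
    ring)
  have hKU : K = UD U (fun i => (Real.sqrt (x i))⁻¹) := by
    apply root_unique (ud_psd _ fun i => by positivity) (ud_psd _ fun i => by positivity)
    rw [ud_mul hU, ← neg_inj, ← hKK, hA, ud_neg]
    congr 1; ext i; rw [← mul_inv, hss]
  refine ⟨U, hU, ?_, ?_⟩
  · have h1 : X * (K * K) = 1 := by
      rw [← hHH, show H * H * (K * K) = H * (H * K) * K by simp only [Matrix.mul_assoc], hHK,
        Matrix.mul_one, hHK]
    have h2 : (K * K) * UD U x = 1 := by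
      rw [hKU, ud_mul hU, ud_mul hU, ← ud_one hU]
      congr 1; ext i; rw [← mul_inv, hss, inv_mul_cancel₀ (hx0 i).ne']
    exact left_inv_eq_right_inv h1 h2
  · have : Wᴴ * W = K * (H * (Wᴴ * W) * H) * K := by
      rw [show K * (H * (Wᴴ * W) * H) * K = (K * H) * (Wᴴ * W) * (H * K) by
        simp only [Matrix.mul_assoc], hKH, hHK, Matrix.one_mul, Matrix.mul_one]
    rw [this, hZ5, hB, hKU, ud_mul hU, ud_mul hU]
    congr 1; ext i
    rw [div_eq_mul_inv, ← hss i, mul_inv, Real.sqrt_mul_self (Real.sqrt_nonneg _)]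
    ring

lemma iseig_ud {A : Matrix (Fin d) (Fin d) ℂ} {μ : Fin d → ℝ} (h : IsEigListM A μ) :
    ∃ U : Matrix (Fin d) (Fin d) ℂ, Uᴴ * U = 1 ∧ A = UD U μ := by
  obtain ⟨_, hA, σ, hσ⟩ := h
  have hU : (hA.eigenvectorUnitary : Matrix (Fin d) (Fin d) ℂ)ᴴ * hA.eigenvectorUnitary = 1 :=
    Unitary.coe_star_mul_self _
  refine ⟨_, perm_unitary hU σ, ?_⟩
  have : μ = hA.eigenvalues ∘ σ := funext hσ
  rw [this, ← ud_perm]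
  exact hA.spectral_theorem

lemma basis_of_ud {S A U : Matrix (Fin d) (Fin d) ℂ} (hU : Uᴴ * U = 1) {s m : Fin d → ℝ}
    (hm : ∀ i, 0 < m i) (hS : S = UD U s) (hA : A = UD U m) :
    ∃ v : Fin d → (Fin d → ℂ),
        (∀ i j, star (v i) ⬝ᵥ v j = if i = j then (1 : ℂ) else 0) ∧
        S = ∑ i, (s i : ℂ) • vecMulVec (v i) (star (v i)) ∧
        ∀ M : Matrix (Fin d) (Fin d) ℂ, M.PosSemidef → M * M = A →
          M = ∑ i, (Real.sqrt (m i) : ℂ) • vecMulVec (v i) (star (v i)) := by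
  refine ⟨fun i j => U j i, fun i j => ?_, ?_, ?_⟩
  · have := congrFun (congrFun hU i) j
    rw [Matrix.mul_apply, Matrix.one_apply] at this
    exact this
  · rw [hS, ud_sum]
  · intro M hM hMM
    rw [← ud_sum U (fun i => Real.sqrt (m i))]
    refine root_unique hM (ud_psd _ fun i => Real.sqrt_nonneg _) ?_
    rw [hMM, hA, ud_mul hU]
    congr 1; ext i; exact (Real.mul_self_sqrt (hm i).le).symm

lemma pprodd_all (x : Fin d → ℝ) : pprodd x d = ∏ i, x i := by
  simp [pprodd]

lemma card_lt {k : ℕ} (hk : k < d) :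
    (Finset.univ.filter (fun i : Fin d => (i : ℕ) < k)).card = k := by
  rw [Fin.card_filter_val_lt]; omega

end helpers

/-- Multiplicative Lidskii inequality with equality case. -/
theorem stmt_7 {d : ℕ} (S Vm : Matrix (Fin d) (Fin d) ℂ) (hS : S.PosDef)
    (lam : Fin d → ℝ) (hlam : Antitone lam) (hlampos : ∀ i, 0 < lam i)
    (hV : IsEigListM (Vmᴴ * Vm) lam)
    (lamS lamVSV : Fin d → ℝ)
    (hlamS : IsEigListM S lamS)
    (hlamVSV : IsEigListM (Vm * S * Vmᴴ) lamVSV) :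
    -- the log-majorization inequalities λ(S)∘λ↑ ≺_log λ(V S V^*) ≺_log λ(S)∘λ
    LogMaj (fun i => lamS i * lam (Fin.rev i)) lamVSV ∧
    LogMaj lamVSV (fun i => lamS i * lam i) ∧
    -- equality case λ(V S V^*) = (λ(S)∘λ↑)↓
    ((∃ σ : Equiv.Perm (Fin d), ∀ i, lamVSV i = lamS (σ i) * lam (Fin.rev (σ i))) →
      ∃ v : Fin d → (Fin d → ℂ),
        (∀ i j, star (v i) ⬝ᵥ v j = if i = j then (1 : ℂ) else 0) ∧
        S = ∑ i, (lamS i : ℂ) • vecMulVec (v i) (star (v i)) ∧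
        ∀ M : Matrix (Fin d) (Fin d) ℂ, M.PosSemidef → M * M = Vmᴴ * Vm →
          M = ∑ i, (Real.sqrt (lam (Fin.rev i)) : ℂ) • vecMulVec (v i) (star (v i))) ∧
    -- equality case λ(V S V^*) = λ(S)∘λ
    ((∀ i, lamVSV i = lamS i * lam i) →
      ∃ v : Fin d → (Fin d → ℂ),
        (∀ i j, star (v i) ⬝ᵥ v j = if i = j then (1 : ℂ) else 0) ∧
        S = ∑ i, (lamS i : ℂ) • vecMulVec (v i) (star (v i)) ∧
        ∀ M : Matrix (Fin d) (Fin d) ℂ, M.PosSemidef → M * M = Vmᴴ * Vm →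
          M = ∑ i, (Real.sqrt (lam i) : ℂ) • vecMulVec (v i) (star (v i))) := by
  have hz : Antitone lamVSV := hlamVSV.1
  have hs : Antitone lamS := hlamS.1
  have hs0 : ∀ i, 0 < lamS i := by
    obtain ⟨_, hA, σ, hσ⟩ := hlamS
    intro i; rw [hσ]; exact hS.eigenvalues_pos _
  obtain ⟨U1, hU1, hSU⟩ := iseig_ud hlamS
  obtain ⟨U2, hU2, hVU⟩ := iseig_ud hV
  obtain ⟨U3, hU3, hZU⟩ := iseig_ud hlamVSV
  have hdet : ∏ i, lamVSV i = (∏ i, lamS i) * ∏ i, lam i := by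
    have h1 : (Vm * S * Vmᴴ).det = S.det * (Vmᴴ * Vm).det := by
      simp only [det_mul]; ring
    rw [hZU, hVU, hSU, ud_det hU1, ud_det hU2, ud_det hU3, ← Complex.ofReal_mul] at h1
    exact Complex.ofReal_injective h1
  have hz0 : ∀ i, 0 < lamVSV i := by
    have hnn : ∀ i, 0 ≤ lamVSV i := by
      obtain ⟨_, hA, σ, hσ⟩ := hlamVSV
      intro i; rw [hσ]
      exact (hS.posSemidef.mul_mul_conjTranspose_same Vm).eigenvalues_nonneg _
    have hne : ∏ i, lamVSV i ≠ 0 := by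
      rw [hdet]
      exact (mul_pos (Finset.prod_pos fun i _ => hs0 i)
        (Finset.prod_pos fun i _ => hlampos i)).ne'
    intro i
    exact lt_of_le_of_ne (hnn i) (Finset.prod_ne_zero_iff.mp hne i (Finset.mem_univ _)).symm
  -- the auxiliary inverse
  set L := UD U2 (fun i => (lam i)⁻¹) with hL
  have hLV : L * (Vmᴴ * Vm) = 1 := by
    rw [hVU, hL, ud_mul hU2, ← ud_one hU2]
    congr 1; ext i; exact inv_mul_cancel₀ (hlampos i).ne'
  have hLh : Lᴴ = L := ud_herm _ _
  set Vi := L * Vmᴴ with hVi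
  have hViV : Vi * Vm = 1 := by rw [hVi, Matrix.mul_assoc, hLV]
  have hVVi : Vm * Vi = 1 := mul_eq_one_comm.mp hViV
  have hViV' : Vmᴴ * Viᴴ = 1 := by rw [← conjTranspose_mul, hViV, conjTranspose_one]
  have hVVi' : Viᴴ * Vmᴴ = 1 := by rw [← conjTranspose_mul, hVVi, conjTranspose_one]
  set x : Fin d → ℝ := fun i => (lam (Fin.rev i))⁻¹ with hx
  have hx0 : ∀ i, 0 < x i := fun i => inv_pos.mpr (hlampos _)
  have hxa : Antitone x := fun i j hij => inv_anti₀ (hlampos _) (hlam (Fin.rev_le_rev.mpr hij))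
  obtain ⟨U6, hU6, hXU⟩ : ∃ U : Matrix (Fin d) (Fin d) ℂ, Uᴴ * U = 1 ∧ Viᴴ * Vi = UD U x := by
    apply exists_ud_of_charpoly (isHermitian_conjTranspose_mul_self _)
    have h1 : Vi * Viᴴ = L := by
      rw [hVi, conjTranspose_mul, conjTranspose_conjTranspose, hLh,
        show L * Vmᴴ * (Vm * L) = L * (Vmᴴ * Vm) * L by simp only [Matrix.mul_assoc], hLV,
        Matrix.one_mul]
    rw [charpoly_mul_comm, h1, hL, ud_charpoly hU2, hx]
    exact (Equiv.prod_comp Fin.revPerm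
      (fun i => Polynomial.X - Polynomial.C (((lam i)⁻¹ : ℝ) : ℂ))).symm
  set H := UD U1 (fun i => Real.sqrt (lamS i)) with hH
  have hHH : H * H = S := by
    rw [hH, ud_mul hU1, hSU]
    congr 1; ext i; exact Real.mul_self_sqrt (hs0 i).le
  have hHh : Hᴴ = H := ud_herm _ _
  have hWW : (H * Vmᴴ)ᴴ * (H * Vmᴴ) = Vm * S * Vmᴴ := by
    rw [conjTranspose_mul, conjTranspose_conjTranspose, hHh, ← hHH]
    simp only [Matrix.mul_assoc]
  have hWX : (H * Vmᴴ) * (Viᴴ * Vi) * (H * Vmᴴ)ᴴ = S := by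
    have e : (H * Vmᴴ)ᴴ = Vm * H := by
      rw [conjTranspose_mul, conjTranspose_conjTranspose, hHh]
    rw [e,
      show (H * Vmᴴ) * (Viᴴ * Vi) * (Vm * H) = H * (Vmᴴ * Viᴴ) * (Vi * Vm) * H by
        simp only [Matrix.mul_assoc], hViV', hViV, Matrix.mul_one, Matrix.mul_one, hHH]
  refine ⟨?_, ?_, ?_, ?_⟩
  · obtain ⟨σ, hσ⟩ := exists_antitone_perm (fun i => lamS i * lam (Fin.rev i))
    refine ⟨σ, 1, hσ, by simpa using hz, ?_, ?_⟩
    · intro k hk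
      set J := (Finset.univ.filter (fun i : Fin d => (i : ℕ) < k)).map σ.toEmbedding with hJ
      have hJc : J.card = k := by rw [hJ, Finset.card_map, card_lt hk]
      have h1 := lidskii hU6 hU3 hU1 hxa hz hs hx0 hz0 hXU (hWW.trans hZU) (hWX.trans hSU) J
      rw [hJc] at h1
      have h2 : pprodd ((fun i => lamS i * lam (Fin.rev i)) ∘ σ) k
          = ∏ i ∈ J, lamS i * lam (Fin.rev i) := by
        rw [hJ, Finset.prod_map]; rfl
      have hP : 0 < ∏ i ∈ J, x i := Finset.prod_pos fun i _ => hx0 i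
      have h3 : (∏ i ∈ J, x i) * ∏ i ∈ J, lam (Fin.rev i) = 1 := by
        rw [← Finset.prod_mul_distrib]
        exact Finset.prod_eq_one fun i _ => inv_mul_cancel₀ (hlampos _).ne'
      rw [h2, Finset.prod_mul_distrib]
      refine le_of_mul_le_mul_left (le_trans (le_of_eq ?_) h1) hP
      rw [mul_left_comm, h3, mul_one]
    · have h0 : ∏ i, ((fun i => lamS i * lam (Fin.rev i)) ∘ σ) i
          = ∏ i, lamS i * lam (Fin.rev i) :=
        Equiv.prod_comp σ (fun i => lamS i * lam (Fin.rev i))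
      rw [pprodd_all, pprodd_all, h0, Finset.prod_mul_distrib]
      have := Equiv.prod_comp Fin.revPerm lam
      simp only [Fin.revPerm_apply] at this
      rw [this, ← hdet]
      simp
  · refine ⟨1, 1, by simpa using hz, ?_, ?_, ?_⟩
    · intro i j hij
      exact mul_le_mul (hs hij) (hlam hij) (hlampos _).le (hs0 _).le
    · intro k hk
      have h1 := lidskii hU1 hU2 hU3 hs hlam hz hs0 hlampos hSU hVU hZU
        (Finset.univ.filter (fun i : Fin d => (i : ℕ) < k))
      rw [card_lt hk] at h1
      refine h1.trans (le_of_eq ?_)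
      simp only [pprodd, ← Finset.prod_mul_distrib]
      rfl
    · rw [pprodd_all, pprodd_all]
      simp only [Equiv.Perm.coe_one, Function.comp_id]
      rw [hdet, Finset.prod_mul_distrib]
  · rintro ⟨σ, hσ⟩
    have hdiv : ∀ i, lamS i / x i = lamS i * lam (Fin.rev i) := by
      intro i; simp [hx]
    obtain ⟨U, hU, hXx, hZx⟩ := lidskii_eq hU6 hU1 hxa hs hx0 hXU (hWX.trans hSU) (by
      rw [hWW, hZU, ud_trace hU3]
      congr 1
      simp only [hdiv, hσ]
      exact Equiv.sum_comp σ (fun i => lamS i * lam (Fin.rev i)))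
    rw [hWW] at hZx
    have hl0 : ∀ i, 0 < lam (Fin.rev i) := fun i => hlampos _
    have hVV : Vm * Vmᴴ = UD U (fun i => lam (Fin.rev i)) := by
      have h1 : (Vm * Vmᴴ) * (Viᴴ * Vi) = 1 := by
        rw [show (Vm * Vmᴴ) * (Viᴴ * Vi) = Vm * (Vmᴴ * Viᴴ) * Vi by simp only [Matrix.mul_assoc],
          hViV', Matrix.mul_one, hVVi]
      have h2 : (Viᴴ * Vi) * UD U (fun i => lam (Fin.rev i)) = 1 := by
        rw [hXx, ud_mul hU, ← ud_one hU]
        congr 1; ext i; exact inv_mul_cancel₀ (hl0 i).ne'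
      exact left_inv_eq_right_inv h1 h2
    set r : Fin d → ℝ := fun i => (Real.sqrt (lam (Fin.rev i)))⁻¹ with hr
    have hrr : ∀ i, r i * r i = (lam (Fin.rev i))⁻¹ := by
      intro i; simp only [hr]; rw [← mul_inv, Real.mul_self_sqrt (hl0 i).le]
    set R := diagonal (fun i => (r i : ℂ)) with hR
    have hRh : Rᴴ = R := by
      rw [hR, diagonal_conjTranspose]; congr 1; ext i; simp
    set Q := Vmᴴ * U * R with hQ
    have hQh : Qᴴ = R * Uᴴ * Vm := by
      rw [hQ, conjTranspose_mul, conjTranspose_mul, conjTranspose_conjTranspose, hRh]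
      simp only [Matrix.mul_assoc]
    have hQQ : Qᴴ * Q = 1 := by
      rw [hQh, hQ, show R * Uᴴ * Vm * (Vmᴴ * U * R) = R * Uᴴ * (Vm * Vmᴴ) * U * R by
        simp only [Matrix.mul_assoc], hVV, UD]
      rw [show ∀ E : Matrix (Fin d) (Fin d) ℂ,
        R * Uᴴ * (U * E * Uᴴ) * U * R = R * (Uᴴ * U) * E * (Uᴴ * U) * R by
          intro E; simp only [Matrix.mul_assoc], hU]
      rw [Matrix.mul_one, Matrix.mul_one, hR, diagonal_mul_diagonal, diagonal_mul_diagonal,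
        ← diagonal_one]
      congr 1; ext i
      have : r i * lam (Fin.rev i) * r i = 1 := by
        rw [mul_right_comm, hrr, inv_mul_cancel₀ (hl0 i).ne']
      exact_mod_cast this
    have hQa : ∀ a : Fin d → ℝ, UD Q a = Vmᴴ * UD U (fun i => a i * (lam (Fin.rev i))⁻¹) * Vm := by
      intro a
      rw [UD, hQh, hQ, UD, show ∀ E : Matrix (Fin d) (Fin d) ℂ,
        Vmᴴ * U * R * E * (R * Uᴴ * Vm) = Vmᴴ * (U * (R * E * R) * Uᴴ) * Vm by
          intro E; simp only [Matrix.mul_assoc]]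
      rw [hR, diagonal_mul_diagonal, diagonal_mul_diagonal]
      congr 5; ext i
      rw [← hrr]; push_cast; ring
    refine basis_of_ud hQQ hl0 ?_ ?_
    · have h1 : Vm * UD Q lamS * Vmᴴ = Vm * S * Vmᴴ := by
        rw [hQa, hZx, show ∀ E : Matrix (Fin d) (Fin d) ℂ,
          Vm * (Vmᴴ * E * Vm) * Vmᴴ = (Vm * Vmᴴ) * E * (Vm * Vmᴴ) by
            intro E; simp only [Matrix.mul_assoc], hVV, ud_mul hU, ud_mul hU]
        congr 1; ext i
        rw [hdiv]
        have := (hl0 i).ne'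
        field_simp
      have h2 : ∀ E : Matrix (Fin d) (Fin d) ℂ, Vi * (Vm * E * Vmᴴ) * Viᴴ = E := by
        intro E
        rw [show Vi * (Vm * E * Vmᴴ) * Viᴴ = (Vi * Vm) * E * (Vmᴴ * Viᴴ) by
          simp only [Matrix.mul_assoc], hViV, hViV', Matrix.one_mul, Matrix.mul_one]
      rw [← h2 S, ← h1, h2]
    · rw [hQa]
      have : (fun i => lam (Fin.rev i) * (lam (Fin.rev i))⁻¹) = fun _ => 1 := by
        ext i; exact mul_inv_cancel₀ (hl0 i).ne'
      rw [this, ud_one hU, Matrix.mul_one]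
  · intro h
    have hdiv : (fun i => lamVSV i / lamS i) = lam := by
      ext i; rw [h, mul_div_cancel_left₀ _ (hs0 i).ne']
    obtain ⟨U, hU, hSx, hVx⟩ := lidskii_eq hU1 hU3 hs hz hs0 hSU hZU (by
      rw [hdiv, hVU, ud_trace hU2])
    rw [hdiv] at hVx
    exact basis_of_ud hU hlampos hSx hVx
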